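/- arXiv:1503.07035 — 2 statements merged into one kernel-verified Lean document; each statement's English description precedes it below -/
import Mathlib

section
/- Let d ≥ 1 and let c₁, c₂, b, ω₀ > 0. Then for every ω > 0 there exist b′, c′ > 0 such that for all t > 0 and all r ≥ 0: min( c₁ t^{−d/2} (1 + t)^{d/2}, c₂ t^{−d/2} e^{−b r²/t} e^{ω₀ t} ) ≤ c′ t^{−d/2} e^{−b′ r²/t} e^{ω t}. -/
theorem one_add_rpow_le_exp {a ε t : ℝ} (ha : 0 < a) (hε : 0 < ε) (ht : 0 ≤ t) :
    (1 + t) ^ a ≤ (1 + a / ε) ^ a * Real.exp (ε * t) := by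
  have hlin : 1 + t ≤ (1 + a / ε) * Real.exp (ε * t / a) := by
    calc 1 + t ≤ (1 + a / ε) * (ε * t / a + 1) := by
          have h : (1 + a / ε) * (ε * t / a + 1) = 1 + t + ε * t / a + a / ε := by
            field_simp
            ring
          rw [h]
          have h₁ : 0 ≤ ε * t / a := by positivity
          have h₂ : 0 ≤ a / ε := by positivity
          linarith
      _ ≤ _ := by gcongr; exact Real.add_one_le_exp _
  calc (1 + t) ^ a ≤ ((1 + a / ε) * Real.exp (ε * t / a)) ^ a := by gcongr
    _ = (1 + a / ε) ^ a * Real.exp (ε * t) := by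
      rw [Real.mul_rpow (by positivity) (by positivity), ← Real.exp_mul,
        div_mul_cancel₀ _ ha.ne']

/-- Self-improvement of Gaussian bounds: if both the on-diagonal bound
`c₁ t^{−d/2}(1+t)^{d/2}` and a Gaussian bound `c₂ t^{−d/2} e^{−br²/t} e^{ω₀t}` hold,
then for every `ω > 0` there are `b′, c′ > 0` with
`min(...) ≤ c′ t^{−d/2} e^{−b′r²/t} e^{ωt}` for all `t > 0`, `r ≥ 0`. -/
theorem stmt_6 (d : ℕ) (hd : 1 ≤ d) (c₁ c₂ b ω₀ : ℝ)
    (hc₁ : 0 < c₁) (hc₂ : 0 < c₂) (hb : 0 < b) (hω₀ : 0 < ω₀) :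
    ∀ ω > (0:ℝ), ∃ b' > (0:ℝ), ∃ c' > (0:ℝ), ∀ t > (0:ℝ), ∀ r ≥ (0:ℝ),
      min (c₁ * t ^ (-(d:ℝ)/2) * (1 + t) ^ ((d:ℝ)/2))
          (c₂ * t ^ (-(d:ℝ)/2) * Real.exp (-b * r ^ 2 / t) * Real.exp (ω₀ * t)) ≤
        c' * t ^ (-(d:ℝ)/2) * Real.exp (-b' * r ^ 2 / t) * Real.exp (ω * t) := by
  intro ω hω
  have ha : 0 < (d : ℝ) / 2 := by
    have : (0 : ℝ) < d := by exact_mod_cast hd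
    positivity
  set a : ℝ := (d : ℝ) / 2
  set M : ℝ := (1 + a / (ω / 2)) ^ a
  have hM : 0 < M := by positivity
  refine ⟨min (b / 2) (ω * b / (4 * ω₀)), by positivity, c₁ * M + c₂, by positivity, ?_⟩
  intro t ht r hr
  set b' := min (b / 2) (ω * b / (4 * ω₀))
  rw [mul_div_assoc (-b), mul_div_assoc (-b')]
  set s := r ^ 2 / t
  have hs : 0 ≤ s := by positivity
  rcases le_total (2 * ω₀ * t) (b * s) with h | h
  · refine (min_le_right _ _).trans ?_
    have hb's : b' * s ≤ b / 2 * s := by gcongr; exact min_le_left _ _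
    have hωt : 0 < ω * t := by positivity
    have hexp : -b * s + ω₀ * t ≤ -b' * s + ω * t := by linarith
    rw [mul_assoc _ (Real.exp _), mul_assoc _ (Real.exp _), ← Real.exp_add, ← Real.exp_add]
    grw [hexp]
    gcongr
    exact le_add_of_nonneg_left (by positivity)
  · refine (min_le_left _ _).trans ?_
    have hb's : b' * s ≤ ω / 2 * t := by
      calc b' * s ≤ ω * b / (4 * ω₀) * s := by gcongr; exact min_le_right _ _
        _ = ω / (4 * ω₀) * (b * s) := by ring
        _ ≤ ω / (4 * ω₀) * (2 * ω₀ * t) := by gcongr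
        _ = ω / 2 * t := by field_simp; ring
    rw [mul_assoc _ (Real.exp _), ← Real.exp_add]
    calc c₁ * t ^ (-(d : ℝ) / 2) * (1 + t) ^ a
        ≤ c₁ * t ^ (-(d : ℝ) / 2) * (M * Real.exp (ω / 2 * t)) := by
          gcongr
          exact one_add_rpow_le_exp ha (by positivity) ht.le
      _ = c₁ * M * t ^ (-(d : ℝ) / 2) * Real.exp (ω / 2 * t) := by ring
      _ ≤ _ := by
        gcongr
        · exact le_add_of_nonneg_right hc₂.le
        · linarith
end

section
/- Let d ≥ 2 and let Ω ⊆ ℝ^d be a bounded open set. Let E = { x = (x̃, x_d) ∈ ℝ^d : −1 < x_d < 1 and ‖x̃‖_{ℝ^{d−1}} < 1 } be the open unit cylinder, E⁻ = { x ∈ E : x_d < 0 } its lower half and P = E ∩ { x ∈ ℝ^d : x_d = 0 } its midplate. Suppose that for every x ∈ ∂Ω there exist an open neighbourhood U_x of x and a bi-Lipschitz map φ_x from an open neighbourhood of the closure of U_x onto an open subset of ℝ^d such that φ_x(U_x) = E, φ_x(Ω ∩ U_x) = E⁻, φ_x(∂Ω ∩ U_x) = P and φ_x(x) = 0. Then there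 exists α > 0 such that |B_R(x) \ Ω| ≥ α |B_R(x)| for all x ∈ ∂Ω and all R ∈ (0,1], where |·| denotes d-dimensional Lebesgue measure and B_R(x) the open Euclidean ball of radius R centred at x. -/
open Set MeasureTheory

/-- `HasExteriorBalls Ω M c` says that every ball `B_R(x)` with centre `x ∈ M` and radius
`R ∈ (0,1]` contains a ball of radius `c * R` that misses `Ω`. -/
def HasExteriorBalls {X : Type*} [PseudoMetricSpace X] (Ω M : Set X) (c : ℝ) : Prop :=
  ∀ x ∈ M, ∀ R ∈ Ioc (0:ℝ) 1, ∃ y, Metric.ball y (c * R) ⊆ Metric.ball x R \ Ω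

theorem HasExteriorBalls.mono {X : Type*} [PseudoMetricSpace X] {Ω M N : Set X} {c c' : ℝ}
    (h : HasExteriorBalls Ω M c) (hN : N ⊆ M) (hc : c' ≤ c) : HasExteriorBalls Ω N c' := by
  intro x hx R hR
  obtain ⟨y, hy⟩ := h x (hN hx) R hR
  have := hR.1
  exact ⟨y, (Metric.ball_subset_ball (by gcongr)).trans hy⟩

/-- On a compact set, exterior balls exist uniformly as soon as they exist locally. -/
theorem IsCompact.exists_hasExteriorBalls {X : Type*} [PseudoMetricSpace X] {Ω M : Set X}
    (hM : IsCompact M)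
    (h : ∀ x ∈ M, ∃ δ > 0, ∃ c > 0, HasExteriorBalls Ω (M ∩ Metric.ball x δ) c) :
    ∃ c > 0, HasExteriorBalls Ω M c := by
  suffices ∃ c > 0, HasExteriorBalls Ω (M ∩ M) c by rwa [inter_self] at this
  refine hM.induction_on (p := fun s => ∃ c > 0, HasExteriorBalls Ω (M ∩ s) c)
    ⟨1, one_pos, fun x hx => hx.2.elim⟩ ?_ ?_ ?_
  · rintro s t hst ⟨c, hc, hcs⟩
    exact ⟨c, hc, hcs.mono (inter_subset_inter_right _ hst) le_rfl⟩
  · rintro s t ⟨c, hc, hcs⟩ ⟨c', hc', hct⟩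
    refine ⟨min c c', lt_min hc hc', ?_⟩
    rintro x ⟨hxM, hx | hx⟩
    · exact hcs.mono subset_rfl (min_le_left _ _) x ⟨hxM, hx⟩
    · exact hct.mono subset_rfl (min_le_right _ _) x ⟨hxM, hx⟩
  · intro x hx
    obtain ⟨δ, hδ, c, hc, hxc⟩ := h x hx
    exact ⟨M ∩ Metric.ball x δ,
      inter_mem_nhdsWithin _ (Metric.ball_mem_nhds x hδ), c, hc,
      hxc.mono inter_subset_right le_rfl⟩

/-- Exterior balls give the outer volume condition. -/
theorem HasExteriorBalls.volume_le {X : Type*} [NormedAddCommGroup X] [NormedSpace ℝ X]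
    [FiniteDimensional ℝ X] [MeasurableSpace X] [BorelSpace X] (μ : Measure X)
    [μ.IsAddHaarMeasure] {Ω M : Set X} {c : ℝ} (hc : 0 < c) (h : HasExteriorBalls Ω M c)
    {x : X} (hx : x ∈ M) {R : ℝ} (hR : R ∈ Ioc (0:ℝ) 1) :
    ENNReal.ofReal (c ^ Module.finrank ℝ X) * μ (Metric.ball x R) ≤
      μ (Metric.ball x R \ Ω) := by
  obtain ⟨y, hy⟩ := h x hx R hR
  refine le_trans (le_of_eq ?_) (measure_mono hy)
  rw [Measure.addHaar_ball_mul_of_pos μ y hc R, Measure.addHaar_ball_center,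
    Measure.addHaar_ball_center]

/-- A bi-Lipschitz chart that sends `Ω` below a hyperplane and the boundary into it yields exterior
balls: move from `φ x` upwards, in the direction of the unit vector `e`, and pull back. -/
theorem hasExteriorBalls_of_chart {X Y : Type*} [PseudoMetricSpace X] [NormedAddCommGroup Y]
    [NormedSpace ℝ Y] {Ω M U : Set X} {φ : X → Y} {e : Y} (he : ‖e‖ = 1) {L : ℝ} (hL : 0 < L)
    (hφ : ∀ y ∈ U, ∀ z ∈ U, L⁻¹ * dist y z ≤ dist (φ y) (φ z) ∧ dist (φ y) (φ z) ≤ L * dist y z)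
    (hup : ∀ x ∈ M ∩ U, ∀ t ∈ Ioo (0:ℝ) 1, φ x + t • e ∈ φ '' U)
    (hout : ∀ x ∈ M ∩ U, ∀ t ∈ Ioo (0:ℝ) 1, ∀ z ∈ Ω ∩ U, φ z ∉ Metric.ball (φ x + t • e) t)
    {x₀ : X} (hU : U ∈ nhds x₀) :
    ∃ δ > 0, ∃ c > 0, HasExteriorBalls Ω (M ∩ Metric.ball x₀ δ) c := by
  obtain ⟨ε, hε, hεU⟩ := Metric.mem_nhds_iff.1 hU
  set δ : ℝ := min (ε / 2) 1
  have hδ : 0 < δ := by positivity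
  have hδ1 : δ ≤ 1 := min_le_right _ _
  have hδε : δ ≤ ε / 2 := min_le_left _ _
  set K : ℝ := L + L⁻¹
  have hK : 0 < K := by positivity
  have hLL : L * L⁻¹ = 1 := mul_inv_cancel₀ hL.ne'
  have hL' : 0 < L⁻¹ := by positivity
  have hK1 : 1 < K := by
    by_contra! hle
    have h1 : L < 1 := by simp only [K] at hle; linarith
    have h2 : L⁻¹ < 1 := by simp only [K] at hle; linarith
    nlinarith
  refine ⟨δ, hδ, L⁻¹ * (δ / K), by positivity, ?_⟩
  rintro x ⟨hxM, hxδ⟩ R ⟨hR, hR1⟩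
  rw [Metric.mem_ball] at hxδ
  have hxU : x ∈ U := hεU (by rw [Metric.mem_ball]; linarith)
  have hRδ : R * δ ≤ δ := by nlinarith
  have hRδ' : R * δ ≤ R := by nlinarith
  set t : ℝ := δ / K * R
  have ht : 0 < t := by positivity
  have htK : t * K = R * δ := by simp only [t]; field_simp
  have ht1 : t < 1 := by nlinarith
  obtain ⟨y, hyU, hy⟩ := hup x ⟨hxM, hxU⟩ t ⟨ht, ht1⟩
  have hyx : dist y x ≤ L * t := by
    have h := (hφ y hyU x hxU).1
    have h2 : dist (φ y) (φ x) = t := by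
      rw [hy, dist_eq_norm, add_sub_cancel_left, norm_smul, he, mul_one, Real.norm_of_nonneg ht.le]
    rw [h2, inv_mul_le_iff₀ hL] at h
    exact h
  refine ⟨y, fun z hz => ?_⟩
  rw [Metric.mem_ball, mul_assoc] at hz
  have hzx : dist z x < R * δ := by
    have := dist_triangle z y x
    have hsum : L⁻¹ * t + L * t = R * δ := by rw [← htK]; ring
    linarith
  have hzU : z ∈ U := hεU <| by
    have := dist_triangle z x x₀
    rw [Metric.mem_ball]; linarith
  refine ⟨by rw [Metric.mem_ball]; linarith, fun hzΩ => ?_⟩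
  refine hout x ⟨hxM, hxU⟩ t ⟨ht, ht1⟩ z ⟨hzΩ, hzU⟩ ?_
  rw [Metric.mem_ball, ← hy]
  refine (hφ z hzU y hyU).2.trans_lt ?_
  rwa [inv_mul_eq_div, lt_div_iff₀' hL] at hz

/-- If the bounded open set `Ω ⊆ ℝ^d` (`d ≥ 2`) is a Lipschitz domain in
the chart sense — every boundary point has a neighbourhood which a bi-Lipschitz map
(defined on a neighbourhood of its closure, with open image) sends to the unit cylinder
`E`, taking `Ω` to the lower half `E⁻` and `∂Ω` to the midplate `P` — then `∂Ω` is of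
class `(A_α)` for some `α > 0`: `|B_R(x) \ Ω| ≥ α |B_R(x)|` for all `x ∈ ∂Ω` and
`R ∈ (0,1]`. -/
theorem stmt_9 (d : ℕ) (hd : 2 ≤ d) (Ω : Set (EuclideanSpace ℝ (Fin d)))
    (hΩo : IsOpen Ω) (hΩb : Bornology.IsBounded Ω)
    (lastc : Fin d) (hlast : lastc = ⟨d - 1, by omega⟩)
    (E Elow P : Set (EuclideanSpace ℝ (Fin d)))
    (hE : E = {x | -1 < x lastc ∧ x lastc < 1 ∧
      Real.sqrt (∑ i ∈ Finset.univ.erase lastc, (x i) ^ 2) < 1})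
    (hElow : Elow = {x ∈ E | x lastc < 0})
    (hP : P = E ∩ {x | x lastc = 0})
    (hchart : ∀ x ∈ frontier Ω,
      ∃ (U V : Set (EuclideanSpace ℝ (Fin d)))
        (φ : EuclideanSpace ℝ (Fin d) → EuclideanSpace ℝ (Fin d)) (L : ℝ),
        IsOpen U ∧ x ∈ U ∧ IsOpen V ∧ closure U ⊆ V ∧ IsOpen (φ '' V) ∧ 0 < L ∧
        (∀ y ∈ V, ∀ z ∈ V,
          L⁻¹ * ‖y - z‖ ≤ ‖φ y - φ z‖ ∧ ‖φ y - φ z‖ ≤ L * ‖y - z‖) ∧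
        φ '' U = E ∧ φ '' (Ω ∩ U) = Elow ∧ φ '' (frontier Ω ∩ U) = P ∧ φ x = 0) :
    ∃ α > (0:ℝ), ∀ x ∈ frontier Ω, ∀ R ∈ Ioc (0:ℝ) 1,
      ENNReal.ofReal α * volume (Metric.ball x R) ≤ volume (Metric.ball x R \ Ω) := by
  have hlocal : ∀ x ∈ frontier Ω, ∃ δ > 0, ∃ c > 0,
      HasExteriorBalls Ω (frontier Ω ∩ Metric.ball x δ) c := by
    intro x hx
    obtain ⟨U, V, φ, L, hUo, hxU, -, hUV, -, hL, hbi, hφE, hφlow, hφP, -⟩ := hchart x hx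
    have hUV' : U ⊆ V := subset_closure.trans hUV
    have hPx : ∀ y ∈ frontier Ω ∩ U, φ y ∈ E ∧ φ y lastc = 0 := fun y hy => by
      have : φ y ∈ P := hφP ▸ mem_image_of_mem φ hy
      rwa [hP] at this
    refine hasExteriorBalls_of_chart (e := EuclideanSpace.single lastc (1:ℝ)) (by simp) hL
      (fun y hy z hz => by simpa only [dist_eq_norm] using hbi y (hUV' hy) z (hUV' hz))
      ?_ ?_ (hUo.mem_nhds hxU)
    · rintro y hy t ⟨ht0, ht1⟩
      obtain ⟨hyE, hy0⟩ := hPx y hy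
      rw [hφE, hE]
      rw [hE] at hyE
      have hlastc : (φ y + t • EuclideanSpace.single lastc (1:ℝ)) lastc = t := by simp [hy0]
      refine ⟨by rw [hlastc]; linarith, by rw [hlastc]; exact ht1, ?_⟩
      rw [Finset.sum_congr rfl (g := fun i => (φ y i) ^ 2)]
      · exact hyE.2.2
      · intro i hi
        simp [Finset.ne_of_mem_erase hi]
    · rintro y hy t - z hz hball
      obtain ⟨-, hy0⟩ := hPx y hy
      have hzlow : φ z ∈ Elow := hφlow ▸ mem_image_of_mem φ hz
      rw [hElow] at hzlow
      have hlt : φ z lastc < 0 := hzlow.2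
      have hcoord := PiLp.norm_apply_le (φ z - (φ y + t • EuclideanSpace.single lastc (1:ℝ))) lastc
      rw [Metric.mem_ball, dist_eq_norm] at hball
      simp only [PiLp.sub_apply, PiLp.add_apply, PiLp.smul_apply, PiLp.single_apply, if_true, hy0,
        smul_eq_mul, mul_one, zero_add, Real.norm_eq_abs] at hcoord
      linarith [neg_abs_le (φ z lastc - t)]
  have hcomp : IsCompact (frontier Ω) :=
    Metric.isCompact_of_isClosed_isBounded isClosed_frontier
      (hΩb.closure.subset frontier_subset_closure)
  obtain ⟨c, hc, hext⟩ := hcomp.exists_hasExteriorBalls hlocal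
  exact ⟨c ^ Module.finrank ℝ (EuclideanSpace ℝ (Fin d)), by positivity,
    fun x hx R hR => hext.volume_le volume hc hx hR⟩
end
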